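/- Let G = H ∗_A K be an amalgamated free product with [H : A] ≥ 3 and [K : A] ≥ 2, and let η : Σ → G be a finite symmetric generating set of G. Then there exist constants C > 0 and 0 < ρ < 1 such that for every n ∈ ℕ the number of cyclically reduced words of length n over Σ representing elliptic elements of G is at most C·ρⁿ times the number of all cyclically reduced words of length n over Σ. -/

import Mathlib

universe u

open Monoid

/-- The number of words of length `n` over `α` lying in `L`. -/
noncomputable def wordCount {α : Type*} (L : Set (List α)) (n : ℕ) : ℕ :=
  Nat.card {w : List α // w ∈ L ∧ w.length = n}

/-- A set of words over a finite alphabet is strongly negligible: the number of its words of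
length `n` is at most `C·ρⁿ·|Σ|ⁿ` for some constants `C > 0` and `0 < ρ < 1`. -/
def StronglyNegligible {α : Type*} [Fintype α] (L : Set (List α)) : Prop :=
  ∃ C ρ : ℝ, 0 < C ∧ 0 < ρ ∧ ρ < 1 ∧ ∀ n : ℕ,
    (wordCount L n : ℝ) ≤ C * ρ ^ n * (Fintype.card α : ℝ) ^ n

/-- A set of words is strongly generic if its complement is strongly negligible. -/
def StronglyGeneric {α : Type*} [Fintype α] (L : Set (List α)) : Prop :=
  StronglyNegligible Lᶜ

/-- `η : α → G` together with the involution `inv` is a symmetric generating set: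
`inv` is a fixed-point-free involution, `η (inv a) = (η a)⁻¹`, and the image of `η`
generates `G` as a group. -/
def IsSymmetricGen {α G : Type*} [Group G] (η : α → G) (inv : α → α) : Prop :=
  (∀ a, inv (inv a) = a) ∧ (∀ a, inv a ≠ a) ∧ (∀ a, η (inv a) = (η a)⁻¹) ∧
    Subgroup.closure (Set.range η) = ⊤

/-- The element of `G` represented by a word over `α`. -/
def evalWord {α G : Type*} [Monoid G] (η : α → G) (w : List α) : G :=
  (w.map η).prod

/-- The two-element family of groups used to realize `H ∗_A K` as a pushout. -/
def AmalgFam (H K : Type u) : Bool → Type u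
  | true => H
  | false => K

instance amalgFamGroup {H K : Type u} [Group H] [Group K] : (b : Bool) → Group (AmalgFam H K b)
  | true => ‹Group H›
  | false => ‹Group K›

/-- The two inclusions of the amalgamated subgroup `A`. -/
def amalgMaps {A : Type*} [Group A] {H K : Type u} [Group H] [Group K]
    (φ : A →* H) (ψ : A →* K) : (b : Bool) → A →* AmalgFam H K b
  | true => φ
  | false => ψ

/-- The amalgamated free product `H ∗_A K`, i.e. the pushout of the two inclusions of `A`. -/
abbrev AmalgProd {A : Type*} [Group A] {H K : Type u} [Group H] [Group K]
    (φ : A →* H) (ψ : A →* K) : Type _ :=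
  Monoid.PushoutI (amalgMaps φ ψ)

/-- The canonical map `H →* H ∗_A K`. -/
def amalgH {A : Type*} [Group A] {H K : Type u} [Group H] [Group K]
    (φ : A →* H) (ψ : A →* K) : H →* AmalgProd φ ψ :=
  Monoid.PushoutI.of (φ := amalgMaps φ ψ) true

/-- The canonical map `K →* H ∗_A K`. -/
def amalgK {A : Type*} [Group A] {H K : Type u} [Group H] [Group K]
    (φ : A →* H) (ψ : A →* K) : K →* AmalgProd φ ψ :=
  Monoid.PushoutI.of (φ := amalgMaps φ ψ) false

/-- An element of `G` is elliptic with respect to the set `S` if it is conjugate in `G`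
to an element of `S`. -/
def IsElliptic {G : Type*} [Group G] (S : Set G) (x : G) : Prop :=
  ∃ h ∈ S, IsConj h x

/-- A word is reduced (w.r.t. the involution `inv`) if no two consecutive letters are of
the form `a`, `inv a`. -/
def Reduced {α : Type*} (inv : α → α) (w : List α) : Prop :=
  List.Chain' (fun a b => b ≠ inv a) w

/-- A word is cyclically reduced if its concatenation with itself is reduced. -/
def CyclicallyReduced {α : Type*} (inv : α → α) (w : List α) : Prop :=
  Reduced inv (w ++ w)


section Cogrowth

open Classical in
/-- The words `w` of length `n` such that `a :: w` is reduced. -/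
noncomputable def redW {α : Type*} [Fintype α] (inv : α → α) : ℕ → α → Finset (List α)
  | 0, _ => {[]}
  | n + 1, a => (Finset.univ.filter (· ≠ inv a)).biUnion fun b => (redW inv n b).image (List.cons b)

theorem mem_redW {α : Type*} [Fintype α] (inv : α → α) (n : ℕ) (a : α) (w : List α) :
    w ∈ redW inv n a ↔ w.length = n ∧ Reduced inv (a :: w) := by
  induction n generalizing a w with
  | zero =>
    simp only [redW, Finset.mem_singleton, List.length_eq_zero_iff]
    constructor
    · rintro rfl
      exact ⟨rfl, List.isChain_singleton _⟩
    · exact fun h => h.1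
  | succ n ih =>
    simp only [redW, Finset.mem_biUnion, Finset.mem_filter, Finset.mem_univ, true_and,
      Finset.mem_image, ih]
    constructor
    · rintro ⟨b, hb, w', ⟨hl, hr⟩, rfl⟩
      refine ⟨by simp [hl], ?_⟩
      unfold Reduced at *
      exact List.isChain_cons_cons.2 ⟨hb, hr⟩
    · rintro ⟨hl, hr⟩
      cases w with
      | nil => simp at hl
      | cons b w' =>
        unfold Reduced at *
        have := List.isChain_cons_cons.1 hr
        exact ⟨b, this.1, w', ⟨by simpa using hl, this.2⟩, rfl⟩

theorem redW_disj {α : Type*} [DecidableEq (List α)] (t : α → Finset (List α)) (s : Set α) :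
    s.PairwiseDisjoint fun b => (t b).image (List.cons b) := by
  intro b _ c _ hbc
  rw [Function.onFun, Finset.disjoint_left]
  intro w hw hw'
  simp only [Finset.mem_image] at hw hw'
  obtain ⟨u, _, rfl⟩ := hw
  obtain ⟨v, _, hv⟩ := hw'
  exact hbc (by simpa using (List.cons.inj hv).1.symm)

open Classical in
theorem card_ne {α : Type*} [Fintype α] (c : α) :
    (Finset.univ.filter (· ≠ c)).card = Fintype.card α - 1 := by
  rw [Finset.filter_ne', Finset.card_erase_of_mem (Finset.mem_univ _), Finset.card_univ]

theorem card_redW {α : Type*} [Fintype α] (inv : α → α) (n : ℕ) (a : α) :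
    (redW inv n a).card = (Fintype.card α - 1) ^ n := by
  classical
  induction n generalizing a with
  | zero => simp [redW]
  | succ n ih =>
    rw [redW, Finset.card_biUnion (redW_disj _ _)]
    simp_rw [Finset.card_image_of_injective _ (List.cons_injective), ih]
    rw [Finset.sum_const, card_ne, smul_eq_mul, pow_succ']

open Classical in
theorem sum_ne {α : Type*} [Fintype α] (c : α) (g : α → ℝ) :
    ∑ b ∈ Finset.univ.filter (· ≠ c), g b = ∑ b, g b - g c := by
  rw [Finset.filter_ne', ← Finset.sum_erase_add _ _ (Finset.mem_univ c)]
  ring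

open Classical in
theorem card_redW_filter_le {α G X : Type*} [Fintype α] [Group G] [MulAction G X]
    (η : α → G) (inv : α → α) (hinv : ∀ a, inv (inv a) = a) (hη : ∀ a, η (inv a) = (η a)⁻¹)
    (f : X → ℝ) (T z c q : ℝ) (hq : q = (Fintype.card α : ℝ) - 1) (hz : 0 < z)
    (hT : ∀ x, ∑ a, f (η a • x) ≤ T * f x)
    (hf : ∀ x, 0 < f x) (hc : ∀ a x, f (η a • x) ≤ c * f x) (hcz : c < z)
    (hTz : T ≤ z + q / z) (p : X) (n : ℕ) (x : X) (a : α) :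
    (((redW inv n a).filter fun w => (evalWord η w)⁻¹ • x = p).card : ℝ) * ((1 - c / z) * f p) ≤
      z ^ n * (f x - f (η a • x) / z) := by
  have hpos : 0 < 1 - c / z := by
    rw [sub_pos, div_lt_one hz]; exact hcz
  have key : ∀ x a, (1 - c / z) * f x ≤ f x - f (η a • x) / z := by
    intro x a
    have := hc a x
    have h2 : f (η a • x) / z ≤ c * f x / z := by gcongr
    have h3 : (1 - c / z) * f x = f x - c * f x / z := by ring
    linarith
  induction n generalizing x a with
  | zero =>
    simp only [redW, pow_zero, one_mul]
    rw [Finset.filter_singleton]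
    by_cases h : x = p
    · subst h
      simpa [evalWord] using key x a
    · have := key x a
      have h5 : 0 < (1 - c / z) * f x := mul_pos hpos (hf x)
      simp [evalWord, h]
      linarith
  | succ n ih =>
    have h1 : ((redW inv (n+1) a).filter fun w => (evalWord η w)⁻¹ • x = p) =
      (Finset.univ.filter (· ≠ inv a)).biUnion fun b =>
        ((redW inv n b).filter fun w => (evalWord η w)⁻¹ • (η (inv b) • x) = p).image
          (List.cons b) := by
      ext w
      simp only [redW, Finset.mem_filter, Finset.mem_biUnion, Finset.mem_image, Finset.mem_univ,
        true_and]
      constructor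
      · rintro ⟨⟨b, hb, w', hw', rfl⟩, h⟩
        refine ⟨b, hb, w', ⟨hw', ?_⟩, rfl⟩
        rw [← h, hη, smul_smul]
        simp [evalWord]
      · rintro ⟨b, hb, w', ⟨hw', h⟩, rfl⟩
        refine ⟨⟨b, hb, w', hw', rfl⟩, ?_⟩
        rw [← h, hη, smul_smul]
        simp [evalWord]
    rw [h1, Finset.card_biUnion (redW_disj _ _)]
    simp_rw [Finset.card_image_of_injective _ (List.cons_injective)]
    push_cast
    rw [Finset.sum_mul]
    refine (Finset.sum_le_sum fun b _ => ih (η (inv b) • x) b).trans ?_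
    rw [← Finset.mul_sum, pow_succ, mul_assoc]
    refine mul_le_mul_of_nonneg_left ?_ (by positivity)
    simp_rw [smul_smul, hη, mul_inv_cancel, one_smul]
    rw [sum_ne]
    have h2 : ∑ b, f ((η b)⁻¹ • x) = ∑ b, f (η b • x) := by
      simp_rw [← hη]
      exact Equiv.sum_comp (⟨inv, inv, hinv, hinv⟩ : α ≃ α) (fun b => f (η b • x))
    rw [Finset.sum_sub_distrib, h2]
    simp only [Finset.sum_const, Finset.card_univ, nsmul_eq_mul, hη, inv_inv]
    have h3 := hT x
    have h4 : (z + q / z - T) * f x ≥ 0 := mul_nonneg (by linarith) (hf x).le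
    have h5 : z * (f x - f (η a • x) / z) = z * f x - f (η a • x) := by field_simp
    have h6 : (Fintype.card α : ℝ) * (f x / z) = q / z * f x + f x / z := by
      rw [hq]; ring
    rw [h5, h6]
    linarith

/-- The ratio bound. -/
theorem exists_ratio {α G X : Type*} [Fintype α] [Nonempty α] [Group G] [MulAction G X] [Nonempty X]
    (η : α → G) (inv : α → α) (hη : ∀ a, η (inv a) = (η a)⁻¹)
    (f : X → ℝ) (T q : ℝ) (hq : q = (Fintype.card α : ℝ) - 1)
    (hT : ∀ x, ∑ a, f (η a • x) ≤ T * f x)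
    (hf : ∀ x, 0 < f x) :
    ∃ c : ℝ, 0 < c ∧ (∀ a x, f (η a • x) ≤ c * f x) ∧ c + q / c ≤ T := by
  classical
  have hb : ∀ p : α × X, f (η p.1 • p.2) / f p.2 ≤ T := by
    rintro ⟨a, x⟩
    rw [div_le_iff₀ (hf x)]
    exact (Finset.single_le_sum (f := fun a => f (η a • x)) (fun b _ => (hf _).le)
      (Finset.mem_univ a)).trans (hT x)
  have hbdd : BddAbove (Set.range fun p : α × X => f (η p.1 • p.2) / f p.2) :=
    ⟨T, by rintro _ ⟨p, rfl⟩; exact hb p⟩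
  set c := ⨆ p : α × X, f (η p.1 • p.2) / f p.2 with hcdef
  have hc : ∀ a x, f (η a • x) ≤ c * f x := by
    intro a x
    rw [← div_le_iff₀ (hf x)]
    exact le_ciSup hbdd (a, x)
  have hcpos : 0 < c := by
    obtain ⟨a⟩ := ‹Nonempty α›
    obtain ⟨x⟩ := ‹Nonempty X›
    exact lt_of_lt_of_le (div_pos (hf _) (hf _)) (le_ciSup hbdd (a, x))
  refine ⟨c, hcpos, hc, ?_⟩
  have : c ≤ T - q / c := by
    apply ciSup_le
    rintro ⟨a, x⟩
    rw [div_le_iff₀ (hf x)]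
    have h1 := hT x
    have h2 : ∀ b, f x / c ≤ f (η b • x) := by
      intro b
      rw [div_le_iff₀ hcpos, mul_comm]
      have := hc (inv b) (η b • x)
      rwa [hη, inv_smul_smul] at this
    have h3 : ∑ b ∈ Finset.univ.filter (· ≠ a), f x / c ≤
        ∑ b ∈ Finset.univ.filter (· ≠ a), f (η b • x) := Finset.sum_le_sum fun b _ => h2 b
    rw [sum_ne, sum_ne] at h3
    simp only [Finset.sum_const, Finset.card_univ, nsmul_eq_mul] at h3
    have h6 : (Fintype.card α : ℝ) * (f x / c) = q / c * f x + f x / c := by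
      rw [hq]; ring
    show f (η a • x) ≤ (T - q / c) * f x
    linarith
  linarith

open Classical in
theorem cogrowth {α G X : Type*} [Fintype α] [Nonempty α] [Group G] [MulAction G X] [Nonempty X]
    (η : α → G) (inv : α → α) (hinv : ∀ a, inv (inv a) = a) (hne : ∀ a, inv a ≠ a)
    (hη : ∀ a, η (inv a) = (η a)⁻¹)
    (f : X → ℝ) (T : ℝ) (hTα : T < Fintype.card α)
    (hT : ∀ x, ∑ a, f (η a • x) ≤ T * f x)
    (hf : ∀ x, 0 < f x) :
    3 ≤ Fintype.card α ∧ ∃ z : ℝ, 0 < z ∧ z < (Fintype.card α : ℝ) - 1 ∧ ∀ p : X, ∃ C : ℝ, 0 < C ∧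
      ∀ (n : ℕ) (a : α), (((redW inv n a).filter fun w => (evalWord η w)⁻¹ • p = p).card : ℝ) ≤
        C * z ^ n := by
  obtain ⟨c, hc0, hc, hcT⟩ := exists_ratio η inv hη f T _ rfl hT hf
  set q : ℝ := (Fintype.card α : ℝ) - 1 with hq
  have h3 : 3 ≤ Fintype.card α := by
    by_contra hcon
    have : 2 ≤ Fintype.card α := by
      obtain ⟨a⟩ := ‹Nonempty α›
      exact Fintype.one_lt_card_iff.2 ⟨inv a, a, hne a⟩
    have h2 : Fintype.card α = 2 := by omega
    have hq1 : q = 1 := by rw [hq, h2]; norm_num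
    rw [hq1] at hcT
    rw [h2] at hTα
    have : c + 1 / c ≥ 2 := by
      have : c + 1 / c - 2 = (c - 1) ^ 2 / c := by field_simp; ring
      have h : (c - 1) ^ 2 / c ≥ 0 := by positivity
      linarith
    push_cast at hTα
    linarith
  have hq2 : 2 ≤ q := by
    have : (3 : ℝ) ≤ Fintype.card α := by exact_mod_cast h3
    linarith
  refine ⟨h3, ?_⟩
  set z := max (T - 1) (Real.sqrt q) with hz
  have hsq : Real.sqrt q < q := by
    rw [Real.sqrt_lt' (by linarith)]; nlinarith
  have hzq : z < q := max_lt (by linarith) hsq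
  have hzs : Real.sqrt q ≤ z := le_max_right _ _
  have hs0 : 0 < Real.sqrt q := Real.sqrt_pos.2 (by linarith)
  have hz0 : 0 < z := hs0.trans_le hzs
  have hz2 : q ≤ z ^ 2 := by
    calc q = Real.sqrt q ^ 2 := (Real.sq_sqrt (by linarith)).symm
      _ ≤ z ^ 2 := by gcongr
  have hqz : 1 < q / z := by rwa [lt_div_iff₀ hz0, one_mul]
  have hTz : T < z + q / z := by
    have := le_max_left (T - 1) (Real.sqrt q)
    linarith
  have hcz : c < z := by
    by_contra hcon
    push Not at hcon
    have h1 : c + q / c < z + q / z := by linarith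
    have h2 : c + q / c - (z + q / z) = (c - z) * (c * z - q) / (c * z) := by
      field_simp
      ring
    have h4 : (c - z) * (c * z - q) / (c * z) ≥ 0 := by
      apply div_nonneg (mul_nonneg (by linarith) _) (by positivity)
      nlinarith
    linarith
  refine ⟨z, hz0, hzq, fun p => ⟨f p / ((1 - c / z) * f p), ?_, fun n a => ?_⟩⟩
  all_goals
    have hpos : 0 < 1 - c / z := by
      rw [sub_pos, div_lt_one hz0]; exact hcz
    have hp := hf p
  · positivity
  · have := card_redW_filter_le η inv hinv hη f T z c q hq hz0 hT hf hc hcz hTz.le p n p a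
    rw [div_mul_eq_mul_div, le_div_iff₀ (by positivity)]
    refine this.trans ?_
    rw [mul_comm]
    gcongr
    have : 0 < f (η a • p) / z := div_pos (hf _) hz0
    linarith

end Cogrowth

section Spectral

open scoped ENNReal

variable {X : Type*}

/-- Real square-summable functions. -/
abbrev L2 (X : Type*) := lp (fun _ : X => ℝ) 2

theorem L2_memlp {f : X → ℝ} (h : Summable fun x => f x ^ 2) : Memℓp f 2 := by
  apply memℓp_gen
  simpa using h

theorem L2_summable (ξ : L2 X) : Summable fun x => ξ x ^ 2 := by
  have := (lp.memℓp ξ).summable (by norm_num)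
  simpa using this

theorem L2_norm_sq (ξ : L2 X) : ‖ξ‖ ^ 2 = ∑' x, ξ x ^ 2 := by
  have := lp.norm_rpow_eq_tsum (p := 2) (by norm_num) ξ
  simpa using this

/-- Build an element of `L2`. -/
def L2mk (f : X → ℝ) (h : Summable fun x => f x ^ 2) : L2 X := ⟨f, L2_memlp h⟩

theorem L2mk_apply (f : X → ℝ) (h : Summable fun x => f x ^ 2) (x : X) : L2mk f h x = f x := rfl

variable {G : Type*} [Group G] [MulAction G X]

/-- The translation by `g` on `L2`. -/
noncomputable def shift (g : G) : L2 X →ₗᵢ[ℝ] L2 X where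
  toFun ξ := L2mk (fun x => ξ (g • x))
    ((L2_summable ξ).comp_injective (MulAction.injective g))
  map_add' ξ ζ := by
    apply lp.ext; rfl
  map_smul' c ξ := by
    apply lp.ext; rfl
  norm_map' ξ := by
    rw [← sq_eq_sq₀ (norm_nonneg _) (norm_nonneg _), L2_norm_sq, L2_norm_sq]
    exact (MulAction.toPerm g).tsum_eq (fun x => ξ x ^ 2)

theorem shift_apply (g : G) (ξ : L2 X) (x : X) : shift g ξ x = ξ (g • x) := rfl

open Classical in
/-- Restriction to a set. -/
noncomputable def restr (S : Set X) (ξ : L2 X) : L2 X :=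
  L2mk (fun x => if x ∈ S then ξ x else 0) (by
    refine Summable.of_nonneg_of_le (fun x => sq_nonneg _) (fun x => ?_) (L2_summable ξ)
    split_ifs
    · exact le_rfl
    · simpa using sq_nonneg _)

open Classical in
theorem restr_apply (S : Set X) (ξ : L2 X) (x : X) :
    restr S ξ x = if x ∈ S then ξ x else 0 := rfl

theorem restr_sub (S : Set X) (ξ ζ : L2 X) : restr S (ξ - ζ) = restr S ξ - restr S ζ := by
  apply lp.ext
  funext x
  simp only [lp.coeFn_sub, Pi.sub_apply, restr_apply]
  split_ifs <;> simp

theorem norm_restr_le (S : Set X) (ξ : L2 X) : ‖restr S ξ‖ ≤ ‖ξ‖ := by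
  rw [← sq_le_sq₀ (norm_nonneg _) (norm_nonneg _), L2_norm_sq, L2_norm_sq]
  refine Summable.tsum_le_tsum (fun x => ?_) (L2_summable _) (L2_summable _)
  rw [restr_apply]
  split_ifs
  · exact le_rfl
  · simpa using sq_nonneg _

theorem norm_restr_le_add (S : Set X) (ξ ζ : L2 X) :
    ‖restr S ξ‖ ≤ ‖restr S ζ‖ + ‖ζ - ξ‖ := by
  have h1 : ‖restr S ξ‖ ≤ ‖restr S ζ‖ + ‖restr S ξ - restr S ζ‖ := norm_le_insert' _ _
  rw [← restr_sub] at h1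
  have := norm_restr_le S (ξ - ζ)
  rw [norm_sub_rev ζ ξ]
  linarith

theorem norm_restr_compl (S : Set X) (ξ : L2 X) :
    ‖restr S ξ‖ ^ 2 + ‖restr Sᶜ ξ‖ ^ 2 = ‖ξ‖ ^ 2 := by
  rw [L2_norm_sq, L2_norm_sq, L2_norm_sq, ← (L2_summable _).tsum_add (L2_summable _)]
  congr 1
  funext x
  simp only [restr_apply, Set.mem_compl_iff]
  split_ifs <;> simp_all

theorem norm_restr_shift_sq (S : Set X) (g : G) (ξ : L2 X) :
    ‖restr S (shift g ξ)‖ ^ 2 = ‖restr {x | g⁻¹ • x ∈ S} ξ‖ ^ 2 := by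
  rw [L2_norm_sq, L2_norm_sq,
    ← (MulAction.toPerm g).tsum_eq (fun x => (restr {x | g⁻¹ • x ∈ S} ξ x) ^ 2)]
  congr 1
  funext x
  have e2 : (MulAction.toPerm g) x = g • x := rfl
  simp only [restr_apply, shift_apply, Set.mem_ofPred_eq]
  rw [e2]
  have e3 : (g⁻¹ • g • x ∈ S) ↔ x ∈ S := by rw [inv_smul_smul]
  by_cases hx : x ∈ S
  · rw [if_pos hx, if_pos (e3.2 hx)]
  · rw [if_neg hx, if_neg (mt e3.1 hx)]

theorem gap_three (Y : Set X) (k h₁ h₂ : G) (hk : ∀ x ∈ Y, k • x ∉ Y)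
    (hh₁ : ∀ x, x ∉ Y → h₁ • x ∈ Y) (hh₂ : ∀ x, x ∉ Y → h₂ • x ∈ Y)
    (hd : ∀ x y, x ∉ Y → y ∉ Y → h₁ • x ≠ h₂ • y) (ξ : L2 X) :
    ‖ξ‖ ≤ 10 * (‖shift k ξ - ξ‖ + ‖shift h₁ ξ - ξ‖ + ‖shift h₂ ξ - ξ‖) := by
  have a1 := norm_restr_le_add Y ξ (shift k ξ)
  have a2 := norm_restr_le_add Yᶜ ξ (shift h₁ ξ)
  have a3 := norm_restr_le_add Yᶜ ξ (shift h₂ ξ)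
  have a4 := norm_restr_compl Y ξ
  have b1 : ‖restr Y (shift k ξ)‖ ≤ ‖restr Yᶜ ξ‖ := by
    rw [← sq_le_sq₀ (norm_nonneg _) (norm_nonneg _), norm_restr_shift_sq, L2_norm_sq, L2_norm_sq]
    refine Summable.tsum_le_tsum (fun x => ?_) (L2_summable _) (L2_summable _)
    simp only [restr_apply, Set.mem_ofPred_eq, Set.mem_compl_iff]
    by_cases h : k⁻¹ • x ∈ Y
    · have := hk _ h
      rw [smul_inv_smul] at this
      simp [h, this]
    · simp only [h, if_false]
      rw [zero_pow two_ne_zero]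
      positivity
  have b2 : ‖restr Yᶜ (shift h₁ ξ)‖ ^ 2 + ‖restr Yᶜ (shift h₂ ξ)‖ ^ 2 ≤ ‖restr Y ξ‖ ^ 2 := by
    rw [norm_restr_shift_sq, norm_restr_shift_sq, L2_norm_sq, L2_norm_sq, L2_norm_sq,
      ← (L2_summable _).tsum_add (L2_summable _)]
    refine Summable.tsum_le_tsum (fun x => ?_) ((L2_summable _).add (L2_summable _)) (L2_summable _)
    simp only [restr_apply, Set.mem_ofPred_eq, Set.mem_compl_iff]
    by_cases e1 : h₁⁻¹ • x ∈ Y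
    · by_cases e2 : h₂⁻¹ • x ∈ Y
      · simp only [e1, e2, not_true_eq_false, if_false]
        rw [zero_pow two_ne_zero, add_zero]
        positivity
      · have := hh₂ _ e2
        rw [smul_inv_smul] at this
        simp [e1, e2, this]
    · by_cases e2 : h₂⁻¹ • x ∈ Y
      · have := hh₁ _ e1
        rw [smul_inv_smul] at this
        simp [e1, e2, this]
      · exact absurd (by simp) (hd _ _ e1 e2)
  set e1 := ‖shift k ξ - ξ‖
  set e2 := ‖shift h₁ ξ - ξ‖
  set e3 := ‖shift h₂ ξ - ξ‖
  set u1 := ‖restr Yᶜ (shift h₁ ξ)‖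
  set u2 := ‖restr Yᶜ (shift h₂ ξ)‖
  set v := ‖restr Y (shift k ξ)‖
  set y := ‖restr Y ξ‖
  set z := ‖restr Yᶜ ξ‖
  have n1 : 0 ≤ e1 := norm_nonneg _
  have n2 : 0 ≤ e2 := norm_nonneg _
  have n3 : 0 ≤ e3 := norm_nonneg _
  have n4 : 0 ≤ u1 := norm_nonneg _
  have n5 : 0 ≤ u2 := norm_nonneg _
  have n6 : 0 ≤ y := norm_nonneg _
  have n7 : 0 ≤ z := norm_nonneg _
  set e := e1 + e2 + e3 with he
  have ne : 0 ≤ e := by positivity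
  have c1 : y ≤ z + e := by linarith
  have c2 : z ≤ u1 + e := by linarith
  have c3 : z ≤ u2 + e := by linarith
  have hz6 : z ≤ 6 * e := by
    by_contra hcon
    push Not at hcon
    have d1 : (z - e) ^ 2 ≤ u1 ^ 2 := by gcongr <;> linarith
    have d2 : (z - e) ^ 2 ≤ u2 ^ 2 := by gcongr <;> linarith
    have d3 : y ^ 2 ≤ (z + e) ^ 2 := by gcongr
    nlinarith
  have hy : y ≤ 7 * e := by linarith
  have : ‖ξ‖ ^ 2 ≤ (10 * e) ^ 2 := by
    have d1 : y ^ 2 ≤ (7 * e) ^ 2 := by gcongr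
    have d2 : z ^ 2 ≤ (6 * e) ^ 2 := by gcongr
    nlinarith
  exact (sq_le_sq₀ (norm_nonneg _) (by positivity)).1 this

theorem shift_bound {α : Type*} [Fintype α] (η : α → G)
    (hgen : Subgroup.closure (Set.range η) = ⊤) (g : G) :
    ∃ D : ℝ, 0 ≤ D ∧ ∀ ξ : L2 X, ‖shift g ξ - ξ‖ ≤ D * ∑ a, ‖shift (η a) ξ - ξ‖ := by
  have hg : g ∈ Subgroup.closure (Set.range η) := by rw [hgen]; trivial
  induction hg using Subgroup.closure_induction with
  | mem x hx =>
    obtain ⟨a, rfl⟩ := hx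
    refine ⟨1, zero_le_one, fun ξ => ?_⟩
    rw [one_mul]
    exact Finset.single_le_sum (f := fun a => ‖shift (η a) ξ - ξ‖) (fun b _ => norm_nonneg _)
      (Finset.mem_univ a)
  | one =>
    refine ⟨0, le_rfl, fun ξ => ?_⟩
    have : shift (1 : G) ξ = ξ := by
      apply lp.ext; funext x; simp [shift_apply]
    simp [this]
  | mul x y _ _ hx hy =>
    obtain ⟨D1, h1, H1⟩ := hx
    obtain ⟨D2, h2, H2⟩ := hy
    refine ⟨D1 + D2, by positivity, fun ξ => ?_⟩
    have e : shift (x * y) ξ - ξ = shift y (shift x ξ - ξ) + (shift y ξ - ξ) := by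
      rw [map_sub]
      have : shift (x * y) ξ = shift y (shift x ξ) := by
        apply lp.ext; funext t; simp [shift_apply, mul_smul]
      rw [this]; abel
    rw [e]
    refine (norm_add_le _ _).trans ?_
    rw [LinearIsometry.norm_map, add_mul]
    exact add_le_add (H1 ξ) (H2 ξ)
  | inv x _ hx =>
    obtain ⟨D1, h1, H1⟩ := hx
    refine ⟨D1, h1, fun ξ => ?_⟩
    have e : shift x (shift x⁻¹ ξ - ξ) = ξ - shift x ξ := by
      rw [map_sub]
      have : shift x (shift x⁻¹ ξ) = ξ := by
        apply lp.ext; funext t; simp [shift_apply]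
      rw [this]
    rw [← LinearIsometry.norm_map (shift x), e, norm_sub_rev]
    exact H1 ξ

/-- The lazy averaging operator. -/
noncomputable def lazyOp {α : Type*} [Fintype α] (η : α → G) : L2 X →L[ℝ] L2 X :=
  ContinuousLinearMap.id ℝ _ + ∑ a, (shift (X := X) (η a)).toContinuousLinearMap

theorem lazyOp_def {α : Type*} [Fintype α] (η : α → G) (ξ : L2 X) :
    lazyOp η ξ = ξ + ∑ a, shift (η a) ξ := by
  simp [lazyOp]

theorem lazyOp_apply {α : Type*} [Fintype α] (η : α → G) (ξ : L2 X) (x : X) :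
    lazyOp η ξ x = ξ x + ∑ a, ξ (η a • x) := by
  rw [lazyOp_def, lp.coeFn_add, Pi.add_apply, lp.coeFn_sum, Finset.sum_apply]
  rfl

theorem lazyOp_norm {α : Type*} [Fintype α] [Nonempty α] (η : α → G)
    (D : ℝ) (hD0 : 0 < D) (hD : ∀ ξ : L2 X, ‖ξ‖ ≤ D * ∑ a, ‖shift (η a) ξ - ξ‖) :
    ∃ T : ℝ, 0 ≤ T ∧ T < Fintype.card α + 1 ∧ ‖lazyOp (X := X) η‖ ≤ T := by
  classical
  set m : ℝ := (Fintype.card α : ℝ) with hm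
  have hm1 : 1 ≤ m := by
    rw [hm]; exact_mod_cast Fintype.card_pos
  set c : ℝ := 1 / (D * m) with hc
  have hc0 : 0 < c := by positivity
  set s := Real.sqrt (4 - c ^ 2) with hs
  have hs2 : s < 2 := by
    rw [hs, Real.sqrt_lt' (by norm_num)]
    nlinarith
  have hs0 : 0 ≤ s := Real.sqrt_nonneg _
  refine ⟨m - 1 + s, by linarith, by linarith, ?_⟩
  refine ContinuousLinearMap.opNorm_le_bound _ (by linarith) fun ξ => ?_
  obtain ⟨a, ha⟩ : ∃ a, c * ‖ξ‖ ≤ ‖shift (η a) ξ - ξ‖ := by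
    by_contra hcon
    push Not at hcon
    have h1 : ∑ a, ‖shift (η a) ξ - ξ‖ < ∑ a : α, c * ‖ξ‖ :=
      Finset.sum_lt_sum_of_nonempty Finset.univ_nonempty fun a _ => hcon a
    rw [Finset.sum_const, Finset.card_univ, nsmul_eq_mul, ← hm] at h1
    have h2 := hD ξ
    have h3 : D * (m * (c * ‖ξ‖)) = ‖ξ‖ := by rw [hc]; field_simp
    have h4 := mul_lt_mul_of_pos_left h1 hD0
    linarith
  have hpar := parallelogram_law_with_norm ℝ (shift (η a) ξ) ξ
  rw [LinearIsometry.norm_map] at hpar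
  have hsq : ‖shift (η a) ξ + ξ‖ ≤ s * ‖ξ‖ := by
    have h1 : (c * ‖ξ‖) ^ 2 ≤ ‖shift (η a) ξ - ξ‖ ^ 2 := by gcongr
    have h2 : ‖shift (η a) ξ + ξ‖ ^ 2 ≤ (4 - c ^ 2) * ‖ξ‖ ^ 2 := by nlinarith
    have h3 := Real.le_sqrt_of_sq_le h2
    rwa [Real.sqrt_mul' _ (sq_nonneg _), Real.sqrt_sq (norm_nonneg _)] at h3
  have e : lazyOp η ξ = (shift (η a) ξ + ξ) + ∑ b ∈ Finset.univ.erase a, shift (η b) ξ := by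
    rw [lazyOp_def, ← Finset.add_sum_erase _ _ (Finset.mem_univ a)]
    abel
  rw [e]
  refine (norm_add_le _ _).trans ?_
  have h5 : ‖∑ b ∈ Finset.univ.erase a, shift (η b) ξ‖ ≤ (m - 1) * ‖ξ‖ := by
    refine (norm_sum_le _ _).trans ?_
    simp only [LinearIsometry.norm_map, Finset.sum_const, nsmul_eq_mul]
    rw [Finset.card_erase_of_mem (Finset.mem_univ _), Finset.card_univ,
      Nat.cast_sub Fintype.card_pos]
    simp [hm]
  linarith

/-- Evaluation at a point. -/
noncomputable def evL2 (x : X) : L2 X →L[ℝ] ℝ :=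
  LinearMap.mkContinuous
    { toFun := fun ξ => ξ x
      map_add' := fun _ _ => rfl
      map_smul' := fun _ _ => rfl } 1 (fun ξ => by
        rw [one_mul]; exact lp.norm_apply_le_norm (by norm_num) ξ x)

theorem evL2_apply (x : X) (ξ : L2 X) : evL2 x ξ = ξ x := rfl

theorem exists_superharmonic {α : Type*} [Fintype α] [Nonempty α] [Nonempty X]
    [MulAction.IsPretransitive G X] (η : α → G) (inv : α → α)
    (hη : ∀ a, η (inv a) = (η a)⁻¹) (hgen : Subgroup.closure (Set.range η) = ⊤)
    (Y : Set X) (k h₁ h₂ : G) (hk : ∀ x ∈ Y, k • x ∉ Y)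
    (hh₁ : ∀ x, x ∉ Y → h₁ • x ∈ Y) (hh₂ : ∀ x, x ∉ Y → h₂ • x ∈ Y)
    (hd : ∀ x y, x ∉ Y → y ∉ Y → h₁ • x ≠ h₂ • y) :
    ∃ (f : X → ℝ) (T : ℝ), T < Fintype.card α ∧ (∀ x, ∑ a, f (η a • x) ≤ T * f x) ∧
      ∀ x, 0 < f x := by
  classical
  obtain ⟨D1, p1, H1⟩ := shift_bound (X := X) η hgen k
  obtain ⟨D2, p2, H2⟩ := shift_bound (X := X) η hgen h₁
  obtain ⟨D3, p3, H3⟩ := shift_bound (X := X) η hgen h₂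
  obtain ⟨T0, hT00, hT0, hB⟩ := lazyOp_norm (X := X) η (10 * (D1 + D2 + D3) + 1) (by positivity) (by
    intro ξ
    have := gap_three Y k h₁ h₂ hk hh₁ hh₂ hd ξ
    have q1 := H1 ξ
    have q2 := H2 ξ
    have q3 := H3 ξ
    have q4 : 0 ≤ ∑ a, ‖shift (η a) ξ - ξ‖ := Finset.sum_nonneg fun _ _ => norm_nonneg _
    nlinarith)
  obtain ⟨T, hT1, hT2⟩ := exists_between hT0
  have hTpos : 0 < T := hT00.trans_lt hT1
  obtain ⟨p⟩ := ‹Nonempty X›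
  set B := T⁻¹ • lazyOp (X := X) η with hBdef
  have hB1 : ‖B‖ < 1 := by
    rw [hBdef, norm_smul, norm_inv, Real.norm_of_nonneg hTpos.le, inv_mul_lt_iff₀ hTpos]
    linarith
  set δ : L2 X := lp.single 2 p (1 : ℝ) with hδ
  have hδ0 : ∀ x, 0 ≤ δ x := by
    intro x
    by_cases h : x = p
    · subst h; rw [hδ, lp.single_apply_self]; norm_num
    · rw [hδ, lp.single_apply_ne _ _ _ h]
  have hBapply : ∀ (ξ : L2 X) x, B ξ x = T⁻¹ * (ξ x + ∑ a, ξ (η a • x)) := by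
    intro ξ x
    rw [← lazyOp_apply]; rfl
  have hpow : ∀ (n : ℕ) x, 0 ≤ (B ^ n) δ x := by
    intro n
    induction n with
    | zero => intro x; simpa using hδ0 x
    | succ n ih =>
      intro x
      rw [pow_succ', mul_apply_eq_comp, hBapply]
      exact mul_nonneg (by positivity) (add_nonneg (ih _) (Finset.sum_nonneg fun a _ => ih _))
  have hsum : Summable fun n : ℕ => B ^ n := summable_geometric_of_norm_lt_one hB1
  set F : L2 X := (∑' n : ℕ, B ^ n) δ with hF
  have hF0 : ∀ x, 0 ≤ F x := by
    intro x
    have h1 : HasSum (fun n : ℕ => evL2 x ((B ^ n) δ)) (evL2 x F) := by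
      have h2 := hsum.hasSum.mapL (ContinuousLinearMap.apply ℝ (L2 X) δ)
      exact h2.mapL (evL2 x)
    exact h1.nonneg fun n => hpow n x
  have hFeq : F - B F = δ := by
    have h1 := mul_neg_geom_series B hB1
    have h2 := congrArg (fun L : L2 X →L[ℝ] L2 X => L δ) h1
    simpa using h2
  have hFx : ∀ x, F x = δ x + T⁻¹ * (F x + ∑ a, F (η a • x)) := by
    intro x
    have : F = δ + B F := by rw [← hFeq]; abel
    have h2 := congrArg (fun L : L2 X => L x) this
    simp only [lp.coeFn_add, Pi.add_apply, hBapply] at h2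
    exact h2
  have hmain : ∀ x, ∑ a, F (η a • x) ≤ (T - 1) * F x := by
    intro x
    have h1 := hFx x
    have h2 := hδ0 x
    have h3 : T * (T⁻¹ * (F x + ∑ a, F (η a • x))) = F x + ∑ a, F (η a • x) := by
      field_simp
    have h4 : T⁻¹ * (F x + ∑ a, F (η a • x)) ≤ F x := by linarith
    have := mul_le_mul_of_nonneg_left h4 hTpos.le
    rw [h3] at this
    linarith
  have hp : 0 < F p := by
    have h1 := hFx p
    have h2 : δ p = 1 := by rw [hδ, lp.single_apply_self]
    have h3 : 0 ≤ T⁻¹ * (F p + ∑ a, F (η a • p)) :=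
      mul_nonneg (by positivity) (add_nonneg (hF0 _) (Finset.sum_nonneg fun a _ => hF0 _))
    linarith
  refine ⟨fun x => F x, T - 1, by linarith, hmain, fun x => ?_⟩
  have hz : ∀ x, F x = 0 → ∀ a, F (η a • x) = 0 := by
    intro x hx a
    have h1 := hmain x
    rw [hx, mul_zero] at h1
    have h2 := Finset.single_le_sum (f := fun a => F (η a • x)) (fun b _ => hF0 _)
      (Finset.mem_univ a)
    exact le_antisymm (h2.trans h1) (hF0 _)
  have hz2 : ∀ g : G, ∀ x, F x = 0 ↔ F (g • x) = 0 := by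
    intro g
    have hg : g ∈ Subgroup.closure (Set.range η) := by rw [hgen]; trivial
    induction hg using Subgroup.closure_induction with
    | mem g hg =>
      obtain ⟨a, rfl⟩ := hg
      refine fun x => ⟨fun h => hz x h a, fun h => ?_⟩
      have := hz _ h (inv a)
      rwa [hη, inv_smul_smul] at this
    | one => simp
    | mul g h _ _ hg hh => intro x; rw [mul_smul, ← hg, ← hh]
    | inv g _ hg => intro x; rw [hg (g⁻¹ • x), smul_inv_smul]
  refine lt_of_le_of_ne (hF0 x) fun h => ?_
  obtain ⟨g, rfl⟩ := MulAction.exists_smul_eq G p x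
  exact hp.ne' ((hz2 g p).2 h.symm)

end Spectral

section Tree

set_option linter.unusedSectionVars false

open Monoid Monoid.PushoutI Monoid.PushoutI.NormalWord

variable {A : Type*} [Group A] {Gf : Bool → Type*} [∀ i, Group (Gf i)] {φ : ∀ i, A →* Gf i}
  [∀ i, DecidableEq (Gf i)] (d : Transversal φ)

/-- The type of the first syllable of the normal form. -/
noncomputable def tau (g : PushoutI φ) : Option Bool := (g • (NormalWord.empty : NormalWord d)).fstIdx

/-- The length of the normal form. -/
noncomputable def plen (g : PushoutI φ) : ℕ :=
  (g • (NormalWord.empty : NormalWord d)).toList.length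

theorem tau_base_mul (a : A) (g : PushoutI φ) : tau d (base φ a * g) = tau d g := by
  unfold tau
  rw [mul_smul, base_smul_def]

theorem plen_base_mul (a : A) (g : PushoutI φ) : plen d (base φ a * g) = plen d g := by
  unfold plen
  rw [mul_smul, base_smul_def]

theorem tau_one : tau d (1 : PushoutI φ) = none := by
  simp [tau, NormalWord.empty, CoprodI.Word.fstIdx, CoprodI.Word.empty]

theorem plen_one : plen d (1 : PushoutI φ) = 0 := by
  simp [plen, NormalWord.empty, CoprodI.Word.empty]

theorem tau_base (a : A) : tau d (base φ a) = none := by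
  have := tau_base_mul d a 1
  rwa [mul_one, tau_one] at this

theorem tau_cons {i : Bool} (x : Gf i) (g : PushoutI φ) (hx : x ∉ (φ i).range)
    (hg : tau d g ≠ some i) : tau d (of i x * g) = some i := by
  unfold tau at *
  rw [mul_smul, ← cons_eq_smul x _ hg hx]
  simp [NormalWord.cons, CoprodI.Word.fstIdx, CoprodI.Word.cons]

theorem plen_cons {i : Bool} (x : Gf i) (g : PushoutI φ) (hx : x ∉ (φ i).range)
    (hg : tau d g ≠ some i) : plen d (of i x * g) = plen d g + 1 := by
  unfold tau at hg
  unfold plen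
  rw [mul_smul, ← cons_eq_smul x _ hg hx]
  simp [NormalWord.cons, CoprodI.Word.cons]

theorem tau_induction {P : PushoutI φ → Prop} (hb : ∀ a, P (base φ a))
    (hc : ∀ i (x : Gf i) g, x ∉ (φ i).range → tau d g ≠ some i → P g → P (of i x * g)) (g) :
    P g := by
  have key : ∀ w : NormalWord d, ∀ a, P (base φ a * w.prod) := by
    intro w
    induction w using consRecOn with
    | empty => intro a; simpa using hb a
    | cons i x w hmw _ hx _ ih =>
      intro a
      have h1 : base φ a * (NormalWord.cons x w hmw hx).prod = of i (φ i a * x) * w.prod := by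
        rw [prod_cons, map_mul, of_apply_eq_base, mul_assoc]
      rw [h1]
      apply hc
      · rwa [Subgroup.mul_mem_cancel_left _ (MonoidHom.mem_range.2 ⟨a, rfl⟩)]
      · unfold tau
        rwa [prod_smul_empty]
      · simpa using ih 1
    | base h w _ ih =>
      intro a
      rw [prod_smul, ← mul_assoc, ← map_mul]
      exact ih _
  have := key (g • NormalWord.empty) 1
  simpa using this

theorem tau_none {g : PushoutI φ} (h : tau d g = none) : ∃ a, g = base φ a := by
  induction g using tau_induction d with
  | hb a => exact ⟨a, rfl⟩
  | hc i x g hx hg _ => rw [tau_cons d x g hx hg] at h; cases h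

theorem of_mem_range {i : Bool} {x : Gf i} (hx : x ∈ (φ i).range) :
    ∃ a, (of i x : PushoutI φ) = base φ a := by
  obtain ⟨a, rfl⟩ := hx
  exact ⟨a, of_apply_eq_base φ i a⟩

theorem plen_mul_le {i : Bool} (x : Gf i) (g : PushoutI φ) :
    plen d (of i x * g) ≤ plen d g + 1 := by
  by_cases hx : x ∈ (φ i).range
  · obtain ⟨a, ha⟩ := of_mem_range (φ := φ) hx
    rw [ha, plen_base_mul]; omega
  by_cases hg : tau d g = some i
  · induction g using tau_induction d with
    | hb a => rw [tau_base] at hg; cases hg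
    | hc j y g hy hg' _ =>
      rw [tau_cons d y g hy hg'] at hg
      cases hg
      rw [plen_cons d y g hy hg', ← mul_assoc, ← map_mul]
      by_cases hxy : x * y ∈ (φ i).range
      · obtain ⟨a, ha⟩ := of_mem_range (φ := φ) hxy
        rw [ha, plen_base_mul]; omega
      · rw [plen_cons d _ g hxy hg']; omega
  · rw [plen_cons d x g hx hg]

theorem tau_of_ne {i j : Bool} (hij : j ≠ i) (x : Gf j) : tau d (of j x : PushoutI φ) ≠ some i := by
  by_cases hx : x ∈ (φ j).range
  · obtain ⟨a, ha⟩ := of_mem_range (φ := φ) hx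
    rw [ha, tau_base]; simp
  · have := tau_cons d x 1 hx (by rw [tau_one]; simp)
    rw [mul_one] at this
    rw [this]
    simpa using hij

theorem tau_mul_of {i j : Bool} (hij : j ≠ i) (x : Gf j) (g : PushoutI φ) :
    tau d (g * of j x) = some i ↔ tau d g = some i := by
  have key : ∀ g : PushoutI φ, (tau d g = some i → tau d (g * of j x) = some i) ∧
      (tau d g ≠ some i → tau d (g * of j x) ≠ some i) := by
    intro g
    induction g using tau_induction d with
    | hb a =>
      rw [tau_base, tau_base_mul]
      exact ⟨fun h => (by cases h), fun _ => tau_of_ne d hij x⟩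
    | hc l y g hy hg ih =>
      rw [tau_cons d y g hy hg]
      by_cases hl : l = i
      · subst hl
        refine ⟨fun _ => ?_, fun h => absurd rfl h⟩
        rw [mul_assoc]
        exact tau_cons d y _ hy (ih.2 hg)
      · have hlj : l = j := by
          revert hl hij; cases l <;> cases i <;> cases j <;> simp
        subst hlj
        refine ⟨fun h => absurd (Option.some.inj h) hl, fun _ => ?_⟩
        by_cases hgi : tau d g = some i
        · have h1 := ih.1 hgi
          rw [mul_assoc, tau_cons d y _ hy (by rw [h1]; simpa using Ne.symm hl)]
          simpa using hl
        · have hn : tau d g = none := by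
            revert hg hgi hl
            generalize tau d g = o
            rcases o with _ | o
            · simp
            · cases l <;> cases i <;> cases o <;> simp
          obtain ⟨a, rfl⟩ := tau_none d hn
          rw [← of_apply_eq_base φ l, ← map_mul, ← map_mul]
          exact tau_of_ne d hij _
  constructor
  · intro h
    by_contra h'
    exact (key g).2 h' h
  · exact (key g).1

/-- The product of a list of syllables. -/
def sval (φ : ∀ i, A →* Gf i) (L : List (Σ i, Gf i)) : PushoutI φ :=
  (L.map fun s => of s.1 s.2).prod


theorem sval_append (L M : List (Σ i, Gf i)) : sval φ (L ++ M) = sval φ L * sval φ M := by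
  simp [sval]


theorem sval_cons (s : Σ i, Gf i) (M : List (Σ i, Gf i)) :
    sval φ (s :: M) = of s.1 s.2 * sval φ M := by
  simp [sval]


theorem sval_nil : sval φ [] = 1 := by
  simp [sval]

theorem plen_sval_le (L : List (Σ i, Gf i)) : plen d (sval φ L) ≤ L.length := by
  induction L with
  | nil => simp [sval_nil, plen_one]
  | cons s L ih =>
    rw [sval_cons, List.length_cons]
    exact (plen_mul_le d _ _).trans (by omega)

theorem reduced_sval (L : List (Σ i, Gf i)) (hc : L.IsChain fun s t => s.1 ≠ t.1)
    (hr : ∀ s ∈ L, s.2 ∉ (φ s.1).range) :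
    plen d (sval φ L) = L.length ∧ tau d (sval φ L) = L.head?.map Sigma.fst := by
  induction L with
  | nil => simp [sval_nil, plen_one, tau_one]
  | cons s L ih =>
    have ih' := ih hc.tail (fun t ht => hr t (List.mem_cons_of_mem _ ht))
    have h1 : tau d (sval φ L) ≠ some s.1 := by
      rw [ih'.2]
      cases L with
      | nil => simp
      | cons t L =>
        have := (List.isChain_cons_cons.1 hc).1
        simpa using this.symm
    have h2 := hr s List.mem_cons_self
    rw [sval_cons]
    exact ⟨by rw [plen_cons d _ _ h2 h1, ih'.1, List.length_cons],
      by rw [tau_cons d _ _ h2 h1]; simp⟩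


theorem exists_sval (g : PushoutI φ) : ∃ L, sval φ L = g := by
  induction g using PushoutI.induction_on with
  | of i g => exact ⟨[⟨i, g⟩], by simp [sval]⟩
  | base h => exact ⟨[⟨true, φ true h⟩], by simp [sval, of_apply_eq_base]⟩
  | mul x y hx hy =>
    obtain ⟨L, rfl⟩ := hx
    obtain ⟨M, rfl⟩ := hy
    exact ⟨L ++ M, sval_append L M⟩

/-- Two syllables whose product is a syllable. -/
def Mergeable (φ : ∀ i, A →* Gf i) (s t : Σ i, Gf i) : Prop :=
  ∃ u : Σ i, Gf i, (of s.1 s.2 * of t.1 t.2 : PushoutI φ) = of u.1 u.2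


theorem mergeable_of_eq {s t : Σ i, Gf i} (h : s.1 = t.1) : Mergeable φ s t := by
  obtain ⟨i, x⟩ := s
  obtain ⟨j, y⟩ := t
  cases h
  exact ⟨⟨i, x * y⟩, by simp⟩


theorem mergeable_of_mem {s t : Σ i, Gf i} (h : s.2 ∈ (φ s.1).range) : Mergeable φ s t := by
  obtain ⟨a, ha⟩ := h
  refine ⟨⟨t.1, φ t.1 a * t.2⟩, ?_⟩
  rw [← ha, map_mul, of_apply_eq_base, of_apply_eq_base]

theorem exists_not_chain {β : Type*} {R : β → β → Prop} (L : List β) (h : ¬ L.IsChain R) :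
    ∃ P s t Q, L = P ++ s :: t :: Q ∧ ¬ R s t := by
  induction L with
  | nil => simp at h
  | cons a L ih =>
    cases L with
    | nil => simp at h
    | cons b L =>
      rw [List.isChain_cons_cons] at h
      by_cases hab : R a b
      · obtain ⟨P, s, t, Q, e, hst⟩ := ih (fun hh => h ⟨hab, hh⟩)
        exact ⟨a :: P, s, t, Q, by rw [e]; rfl, hst⟩
      · exact ⟨[], a, b, L, rfl, hab⟩

/-- Cyclically reduced syllable lists are not elliptic. -/
theorem not_elliptic_of_reduced (d : Transversal φ) (L : List (Σ i, Gf i)) (hL : L ≠ [])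
    (hc : (L ++ L).IsChain fun s t => s.1 ≠ t.1)
    (hr : ∀ s ∈ L, s.2 ∉ (φ s.1).range) (g : PushoutI φ) (i : Bool) (x : Gf i)
    (h : sval φ L = g * of i x * g⁻¹) : False := by
  obtain ⟨M, hM⟩ := exists_sval g
  obtain ⟨N, hN⟩ := exists_sval g⁻¹
  set k := M.length + N.length + 2 with hk
  have hc' := List.isChain_append.1 hc
  have hch : (List.replicate k L).flatten.IsChain fun s t => s.1 ≠ t.1 := by
    rw [List.isChain_flatten (by
      intro hmem
      exact hL (List.eq_of_mem_replicate hmem).symm)]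
    refine ⟨fun l hl => ?_, ?_⟩
    · rw [List.eq_of_mem_replicate hl]; exact hc'.1
    · exact List.isChain_replicate_of_rel _ hc'.2.2
  have hpow : ∀ n : ℕ, sval φ (List.replicate n L).flatten = (sval φ L) ^ n := by
    intro n
    induction n with
    | zero => simp [sval_nil]
    | succ n ih => rw [List.replicate_succ, List.flatten_cons, sval_append, ih, pow_succ']
  have h1 := (reduced_sval d _ hch (fun s hs => by
    rw [List.mem_flatten] at hs
    obtain ⟨l, hl, hs⟩ := hs
    rw [List.eq_of_mem_replicate hl] at hs
    exact hr s hs)).1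
  have h2 : (sval φ L) ^ k = sval φ (M ++ ⟨i, x ^ k⟩ :: N) := by
    rw [h, conj_pow, sval_append, sval_cons, hM, hN, map_pow, mul_assoc]
  rw [hpow, h2] at h1
  have h3 := plen_sval_le d (M ++ ⟨i, x ^ k⟩ :: N)
  rw [h1] at h3
  simp at h3
  have : 1 ≤ L.length := List.length_pos_iff.2 hL
  have : k * 1 ≤ k * L.length := Nat.mul_le_mul_left _ this
  omega

theorem elliptic_rotation (d : Transversal φ) (L : List (Σ i, Gf i)) (h : ∃ (g : PushoutI φ) (i : Bool) (x : Gf i),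
    sval φ L = g * of i x * g⁻¹) :
    ∃ L₁ L₂, L = L₁ ++ L₂ ∧ ∃ (i : Bool) (x : Gf i), sval φ L₂ * sval φ L₁ = of i x := by
  induction hn : L.length using Nat.strong_induction_on generalizing L with
  | _ n ih =>
  subst hn
  by_cases hL : L = []
  · subst hL
    exact ⟨[], [], rfl, true, 1, by simp [sval_nil]⟩
  by_cases hch : L.IsChain fun s t => ¬ Mergeable φ s t
  · by_cases hlf : ∀ s ∈ L.getLast?, ∀ t ∈ L.head?, ¬ Mergeable φ s t
    · exfalso
      have hLL : (L ++ L).IsChain fun s t => ¬ Mergeable φ s t :=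
        List.isChain_append.2 ⟨hch, hch, hlf⟩
      obtain ⟨g, i, x, hx⟩ := h
      refine not_elliptic_of_reduced d L hL (hLL.imp fun s t hst he => hst (mergeable_of_eq he)) ?_
        g i x hx
      intro s hs hmem
      obtain ⟨P, Q, e⟩ := List.append_of_mem hs
      have : (s :: (Q ++ L)).IsChain fun s t => ¬ Mergeable φ s t := by
        have hsplit : L ++ L = P ++ s :: (Q ++ L) := by
          nth_rewrite 1 [e]
          simp
        rw [hsplit] at hLL
        exact (List.isChain_append.1 hLL).2.1
      cases hQ : Q ++ L with
      | nil => exact hL (List.append_eq_nil_iff.1 hQ).2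
      | cons t R =>
        rw [hQ] at this
        exact (List.isChain_cons_cons.1 this).1 (mergeable_of_mem hmem)
    · push Not at hlf
      obtain ⟨s, hs, t, ht, u, hu⟩ := hlf
      cases L with
      | nil => exact absurd rfl hL
      | cons t' L' =>
        have ht' : t' = t := by simpa using ht
        subst ht'
        by_cases hL' : L' = []
        · subst hL'
          exact ⟨[], [t'], rfl, t'.1, t'.2, by simp [sval]⟩
        · obtain ⟨M, s', rfl⟩ : ∃ M s', L' = M ++ [s'] :=
            ⟨L'.dropLast, L'.getLast hL', (List.dropLast_append_getLast hL').symm⟩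
          have hs' : s' = s := by
            rw [← List.cons_append, List.getLast?_append] at hs
            simpa using hs
          subst hs'
          obtain ⟨g, i, x, hx⟩ := h
          have hval : sval φ (u :: M) = of s'.1 s'.2 * sval φ (t' :: (M ++ [s'])) *
              (of s'.1 s'.2)⁻¹ := by
            rw [sval_cons, sval_cons, sval_append, ← hu]
            simp [sval, mul_assoc]
          obtain ⟨L₁, L₂, e, j, y, hy⟩ := ih (u :: M).length (by simp) (u :: M)
            ⟨of s'.1 s'.2 * g, i, x, by rw [hval, hx]; group⟩ rfl
          cases L₁ with
          | nil =>
            simp only [List.nil_append] at e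
            subst e
            refine ⟨t' :: M, [s'], rfl, j, y, ?_⟩
            rw [← hy]
            simp [sval_cons, sval_nil, ← hu, mul_assoc]
          | cons u' C =>
            simp only [List.cons_append, List.cons.injEq] at e
            obtain ⟨rfl, rfl⟩ := e
            refine ⟨t' :: C, L₂ ++ [s'], by simp, j, y, ?_⟩
            rw [← hy]
            simp [sval_cons, sval_append, sval_nil, ← hu, mul_assoc]
  · obtain ⟨P, s, t, Q, rfl, hst⟩ := exists_not_chain L hch
    rw [not_not] at hst
    obtain ⟨u, hu⟩ := hst
    have hval : sval φ (P ++ u :: Q) = sval φ (P ++ s :: t :: Q) := by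
      simp [sval_cons, sval_append, ← hu, mul_assoc]
    obtain ⟨L₁, L₂, e, j, y, hy⟩ := ih (P ++ u :: Q).length (by simp) (P ++ u :: Q)
      (by rw [hval]; exact h) rfl
    rcases List.append_eq_append_iff.1 e with ⟨C, rfl, e2⟩ | ⟨C, rfl, e2⟩
    · cases C with
      | nil =>
        simp only [List.nil_append] at e2
        subst e2
        refine ⟨P, s :: t :: Q, rfl, j, y, ?_⟩
        rw [← hy]
        simp [sval_cons, ← hu, mul_assoc]
      | cons u' C =>
        simp only [List.cons_append, List.cons.injEq] at e2
        obtain ⟨rfl, rfl⟩ := e2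
        refine ⟨P ++ s :: t :: C, L₂, by simp, j, y, ?_⟩
        rw [← hy]
        simp [sval_cons, sval_append, ← hu, mul_assoc]
    · subst e2
      refine ⟨L₁, C ++ s :: t :: Q, by simp, j, y, ?_⟩
      rw [← hy]
      simp [sval_cons, sval_append, ← hu, mul_assoc]

theorem split_flatMap {α β : Type*} (syl : α → List β) (w : List α) (hw : w ≠ []) (L₁ L₂ : List β)
    (h : w.flatMap syl = L₁ ++ L₂) :
    ∃ w₁ a w₂ p s, w = w₁ ++ a :: w₂ ∧ syl a = p ++ s ∧ L₁ = w₁.flatMap syl ++ p ∧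
      L₂ = s ++ w₂.flatMap syl := by
  induction w generalizing L₁ with
  | nil => exact absurd rfl hw
  | cons b w ih =>
    rw [List.flatMap_cons] at h
    rcases List.append_eq_append_iff.1 h with ⟨C, rfl, e⟩ | ⟨C, e, rfl⟩
    · by_cases hw' : w = []
      · subst hw'
        simp only [List.flatMap_nil] at e
        have := List.append_eq_nil_iff.1 e.symm
        exact ⟨[], b, [], syl b, [], rfl, by simp, by simp [this.1], by simp [this.2]⟩
      · obtain ⟨w₁, a, w₂, p, s, rfl, h2, rfl, h4⟩ := ih hw' C e
        exact ⟨b :: w₁, a, w₂, p, s, rfl, h2, by simp, h4⟩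
    · exact ⟨[], b, w, L₁, C, rfl, e, rfl, rfl⟩


theorem sval_flatMap {α : Type*} (η : α → PushoutI φ) (syl : α → List (Σ i, Gf i))
    (hsyl : ∀ a, sval φ (syl a) = η a) (w : List α) :
    sval φ (w.flatMap syl) = evalWord η w := by
  induction w with
  | nil => simp [sval_nil, evalWord]
  | cons a w ih =>
    rw [List.flatMap_cons, sval_append, ih, hsyl]
    simp [evalWord]

/-- Every elliptic word has a rotation lying in one of finitely many vertex stabilizers. -/
theorem elliptic_word (d : Transversal φ) {α : Type*} (η : α → PushoutI φ) (syl : α → List (Σ i, Gf i))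
    (hsyl : ∀ a, sval φ (syl a) = η a) (w : List α) (hw : w ≠ [])
    (h : ∃ (g : PushoutI φ) (i : Bool) (x : Gf i), evalWord η w = g * of i x * g⁻¹) :
    ∃ w₁ a w₂ p, w = w₁ ++ a :: w₂ ∧ p ∈ (syl a).inits ∧ ∃ (i : Bool) (x : Gf i),
      evalWord η (a :: w₂ ++ w₁) = sval φ p * of i x * (sval φ p)⁻¹ := by
  rw [← sval_flatMap η syl hsyl] at h
  obtain ⟨L₁, L₂, e, i, x, hx⟩ := elliptic_rotation d _ h
  obtain ⟨w₁, a, w₂, p, s, rfl, h2, rfl, rfl⟩ := split_flatMap syl w hw L₁ L₂ e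
  refine ⟨w₁, a, w₂, p, rfl, ?_, i, x, ?_⟩
  · rw [List.mem_inits, h2]
    exact List.prefix_append _ _
  · rw [← hx, ← sval_flatMap η syl hsyl]
    simp [sval_append, h2, mul_assoc]

end Tree

section Counting

theorem finset_pick {α : Type*} [Fintype α] (h3 : 3 ≤ Fintype.card α) (b c : α) :
    ∃ x, x ≠ b ∧ x ≠ c := by
  classical
  by_contra hcon
  push Not at hcon
  have : (Finset.univ : Finset α) ⊆ {b, c} := by
    intro x _
    by_cases hx : x = b
    · simp [hx]
    · simp [hcon x hx]
  have h1 := Finset.card_le_card this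
  have h2 : ({b, c} : Finset α).card ≤ 2 := Finset.card_le_two
  rw [Finset.card_univ] at h1
  omega

theorem exists_cyc_letter {α : Type*} [Fintype α] (inv : α → α) (hinv : ∀ a, inv (inv a) = a)
    (hne : ∀ a, inv a ≠ a) (h3 : 3 ≤ Fintype.card α) (u : List α) (hu : Reduced inv u) :
    ∃ x, CyclicallyReduced inv (x :: u) := by
  by_cases h : u = []
  · subst h
    have : Nonempty α := Fintype.card_pos_iff.1 (by omega)
    obtain ⟨x⟩ := this
    refine ⟨x, ?_⟩
    unfold CyclicallyReduced Reduced
    exact List.isChain_cons_cons.2 ⟨(hne x).symm, List.isChain_singleton _⟩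
  · obtain ⟨b, v, rfl⟩ := List.exists_cons_of_ne_nil h
    obtain ⟨x, hx1, hx2⟩ := finset_pick h3 (inv b) (inv ((b :: v).getLast h))
    refine ⟨x, ?_⟩
    unfold CyclicallyReduced Reduced at *
    have hxu : (x :: b :: v).IsChain fun a b => b ≠ inv a :=
      List.isChain_cons_cons.2 ⟨fun e => hx1 (by rw [e, hinv]), hu⟩
    refine List.isChain_append.2 ⟨hxu, hxu, ?_⟩
    intro s hs t ht
    rw [List.head?_cons, Option.mem_some_iff] at ht
    subst ht
    rw [List.getLast?_cons_cons, List.getLast?_eq_getLast_of_ne_nil h, Option.mem_some_iff] at hs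
    subst hs
    exact hx2

theorem wordCount_finite {α : Type*} [Fintype α] (L : Set (List α)) (n : ℕ) :
    {w : List α | w ∈ L ∧ w.length = n}.Finite :=
  (List.finite_length_eq α n).subset fun _ h => h.2

theorem wordCount_eq {α : Type*} (L : Set (List α)) (n : ℕ) :
    wordCount L n = Set.ncard {w : List α | w ∈ L ∧ w.length = n} := by
  unfold wordCount
  exact Nat.card_coe_set_eq _

theorem wordCount_mono {α : Type*} [Fintype α] {L M : Set (List α)} (h : L ⊆ M) (n : ℕ) :
    wordCount L n ≤ wordCount M n := by
  rw [wordCount_eq, wordCount_eq]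
  exact Set.ncard_le_ncard (fun w hw => ⟨h hw.1, hw.2⟩) (wordCount_finite M n)

theorem cyc_lower {α : Type*} [Fintype α] (inv : α → α) (hinv : ∀ a, inv (inv a) = a)
    (hne : ∀ a, inv a ≠ a) (h3 : 3 ≤ Fintype.card α) (m : ℕ) :
    (Fintype.card α - 1) ^ m ≤ wordCount {w : List α | CyclicallyReduced inv w} (m + 1) := by
  classical
  have : Nonempty α := Fintype.card_pos_iff.1 (by omega)
  obtain ⟨a₀⟩ := this
  have hex : ∀ u : List α, ∃ x, Reduced inv u → CyclicallyReduced inv (x :: u) := by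
    intro u
    by_cases h : Reduced inv u
    · obtain ⟨x, hx⟩ := exists_cyc_letter inv hinv hne h3 u h
      exact ⟨x, fun _ => hx⟩
    · exact ⟨a₀, fun h' => absurd h' h⟩
  choose x hx using hex
  rw [wordCount_eq, ← card_redW inv m a₀, ← Set.ncard_coe_finset]
  refine Set.ncard_le_ncard_of_injOn (fun u => x u :: u) ?_ ?_ (wordCount_finite _ _)
  · intro u hu
    rw [Finset.mem_coe, mem_redW] at hu
    refine ⟨hx u ?_, by simp [hu.1]⟩
    have := hu.2
    unfold Reduced at *
    exact this.tail
  · intro u _ v _ huv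
    exact (List.cons.inj huv).2

open Classical in
theorem ell_upper {α ι : Type*} [Fintype α] [Fintype ι] (inv : α → α)
    (hne : ∀ a, inv a ≠ a) (E : List α → Prop) (F : ι → List α → Prop) (z : ℝ)
    (c : ι → ℝ)
    (hF : ∀ i n a, (((redW inv n a).filter (F i)).card : ℝ) ≤ c i * z ^ n)
    (hE : ∀ w, w ≠ [] → E w → ∃ w₁ a w₂ i, w = w₁ ++ a :: w₂ ∧ F i (a :: w₂ ++ w₁))
    (n : ℕ) (hn : n ≠ 0) :
    (wordCount {w : List α | CyclicallyReduced inv w ∧ E w} n : ℝ) ≤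
      (n + 1) * (∑ i, ∑ _a : α, c i) * z ^ n := by
  set U : Finset (List α) := (Finset.range (n + 1)).biUnion fun j => Finset.univ.biUnion fun i : ι =>
    Finset.univ.biUnion fun a : α => ((redW inv n a).filter (F i)).image fun w => w.rotate j with hU
  have h1 : wordCount {w : List α | CyclicallyReduced inv w ∧ E w} n ≤ U.card := by
    rw [wordCount_eq, ← Set.ncard_coe_finset]
    refine Set.ncard_le_ncard ?_ (Finset.finite_toSet _)
    rintro w ⟨⟨hw, hEw⟩, hl⟩
    have hw0 : w ≠ [] := by
      rintro rfl
      exact hn hl.symm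
    obtain ⟨w₁, a, w₂, i, rfl, hi⟩ := hE w hw0 hEw
    simp only [hU, Finset.coe_biUnion, Set.mem_iUnion, Finset.mem_coe, Finset.mem_image,
      Finset.mem_filter, Finset.mem_univ, Finset.mem_range, exists_prop, true_and]
    simp only [List.length_append, List.length_cons] at hl
    refine ⟨(a :: w₂).length, by simp only [List.length_cons]; omega, i, a, a :: w₂ ++ w₁,
      ⟨?_, hi⟩, List.rotate_append_length_eq _ _⟩
    rw [mem_redW]
    refine ⟨by simp; omega, ?_⟩
    unfold CyclicallyReduced Reduced at *
    have h2 : (a :: w₂ ++ w₁).IsChain fun a b => b ≠ inv a :=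
      by
        have hsplit : w₁ ++ a :: w₂ ++ (w₁ ++ a :: w₂) = w₁ ++ ((a :: w₂ ++ w₁) ++ a :: w₂) := by
          simp
        rw [hsplit] at hw
        exact (List.isChain_append.1 (List.isChain_append.1 hw).2.1).1
    rw [List.cons_append] at h2 ⊢
    exact List.isChain_cons_cons.2 ⟨(hne a).symm, h2⟩
  have h2 : (U.card : ℝ) ≤ ∑ _j ∈ Finset.range (n + 1), ∑ i : ι, ∑ _a : α, c i * z ^ n := by
    refine le_trans (Nat.cast_le.2 Finset.card_biUnion_le) ?_
    rw [Nat.cast_sum]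
    refine Finset.sum_le_sum fun j _ => ?_
    refine le_trans (Nat.cast_le.2 Finset.card_biUnion_le) ?_
    rw [Nat.cast_sum]
    refine Finset.sum_le_sum fun i _ => ?_
    refine le_trans (Nat.cast_le.2 Finset.card_biUnion_le) ?_
    rw [Nat.cast_sum]
    refine Finset.sum_le_sum fun a _ => ?_
    exact le_trans (Nat.cast_le.2 Finset.card_image_le) (hF i n a)
  refine le_trans (Nat.cast_le.2 h1) (h2.trans (le_of_eq ?_))
  rw [Finset.sum_const, Finset.card_range, nsmul_eq_mul, mul_assoc, Finset.sum_mul]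
  simp only [Finset.sum_mul]
  push_cast
  rfl

open Classical in
theorem count_final {α ι : Type*} [Fintype α] [Fintype ι] (inv : α → α)
    (hinv : ∀ a, inv (inv a) = a)
    (hne : ∀ a, inv a ≠ a) (h3 : 3 ≤ Fintype.card α)
    (E : List α → Prop) (F : ι → List α → Prop) (z : ℝ) (hz : 0 < z)
    (hzq : z < (Fintype.card α : ℝ) - 1)
    (hF : ∀ i, ∃ c : ℝ, 0 < c ∧ ∀ n a, (((redW inv n a).filter (F i)).card : ℝ) ≤ c * z ^ n)
    (hE : ∀ w, w ≠ [] → E w → ∃ w₁ a w₂ i, w = w₁ ++ a :: w₂ ∧ F i (a :: w₂ ++ w₁)) :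
    ∃ C ρ : ℝ, 0 < C ∧ 0 < ρ ∧ ρ < 1 ∧ ∀ n : ℕ,
      (wordCount {w : List α | CyclicallyReduced inv w ∧ E w} n : ℝ) ≤
        C * ρ ^ n * (wordCount {w : List α | CyclicallyReduced inv w} n : ℝ) := by
  choose c hc0 hc using hF
  set q : ℝ := (Fintype.card α : ℝ) - 1 with hq
  set S : ℝ := ∑ i, ∑ _a : α, c i with hS
  have hS0 : 0 ≤ S := Finset.sum_nonneg fun i _ => Finset.sum_nonneg fun _ _ => (hc0 i).le
  have hq0 : 0 < q := hz.trans hzq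
  obtain ⟨y, hzy, hyq⟩ := exists_between hzq
  have hy : 0 < y := hz.trans hzy
  have hr1 : z / y < 1 := (div_lt_one hy).2 hzy
  have hr0 : 0 ≤ z / y := by positivity
  have ht : Filter.Tendsto (fun n : ℕ => ((n : ℝ) + 1) * (z / y) ^ n) Filter.atTop (nhds 0) := by
    have := (tendsto_self_mul_const_pow_of_lt_one hr0 hr1).add
      (tendsto_pow_atTop_nhds_zero_of_lt_one hr0 hr1)
    rw [add_zero] at this
    refine this.congr fun n => ?_
    ring
  obtain ⟨M, hM⟩ := ht.bddAbove_range
  have hM' : ∀ n : ℕ, ((n : ℝ) + 1) * (z / y) ^ n ≤ M := fun n => hM ⟨n, rfl⟩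
  have hM0 : 0 < M := by
    have := hM' 0
    simp at this
    linarith
  refine ⟨1 + M * S * q, y / q, by positivity, by positivity, (div_lt_one hq0).2 hyq, fun n => ?_⟩
  rcases n with _ | m
  · have h1 : wordCount {w : List α | CyclicallyReduced inv w ∧ E w} 0 ≤
      wordCount {w : List α | CyclicallyReduced inv w} 0 :=
      wordCount_mono (fun w hw => hw.1) 0
    have h2 : (wordCount {w : List α | CyclicallyReduced inv w ∧ E w} 0 : ℝ) ≤
      wordCount {w : List α | CyclicallyReduced inv w} 0 := Nat.cast_le.2 h1
    rw [pow_zero, mul_one]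
    have h4 : 0 ≤ M * S * q := by positivity
    nlinarith [Nat.cast_nonneg (α := ℝ) (wordCount {w : List α | CyclicallyReduced inv w} 0)]
  · have h1 := ell_upper inv hne E F z c hc hE (m + 1) (by omega)
    have h2 : q ^ m ≤ (wordCount {w : List α | CyclicallyReduced inv w} (m + 1) : ℝ) := by
      have := cyc_lower inv hinv hne h3 m
      have h5 : (((Fintype.card α - 1) ^ m : ℕ) : ℝ) ≤ _ := Nat.cast_le.2 this
      rw [Nat.cast_pow, Nat.cast_sub (by omega), Nat.cast_one] at h5
      exact h5
    refine h1.trans ?_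
    have h6 := hM' (m + 1)
    have h7 : (((m + 1 : ℕ) : ℝ) + 1) * z ^ (m + 1) ≤ M * y ^ (m + 1) := by
      rw [div_pow, ← mul_div_assoc, div_le_iff₀ (by positivity)] at h6
      exact h6
    calc (((m + 1 : ℕ) : ℝ) + 1) * S * z ^ (m + 1)
        = S * ((((m + 1 : ℕ) : ℝ) + 1) * z ^ (m + 1)) := by ring
      _ ≤ S * (M * y ^ (m + 1)) := mul_le_mul_of_nonneg_left h7 hS0
      _ = (M * S * q) * (y / q) ^ (m + 1) * q ^ m := by
          rw [div_pow]
          field_simp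
          ring
      _ ≤ (1 + M * S * q) * (y / q) ^ (m + 1) * q ^ m := by
          gcongr
          linarith
      _ ≤ _ := by
          gcongr

end Counting

section Quot

open Classical in
theorem quot_cogrowth {G : Type*} [Group G] (B : Subgroup G) {α : Type*} [Fintype α] [Nonempty α]
    (η : α → G) (inv : α → α)
    (hsym : IsSymmetricGen η inv) (P : Set G) (hP : ∀ x ∈ B, ∀ g, g * x ∈ P ↔ g ∈ P)
    (k h₁ h₂ : G) (hk : ∀ g ∈ P, k * g ∉ P) (hh₁ : ∀ g, g ∉ P → h₁ * g ∈ P)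
    (hh₂ : ∀ g, g ∉ P → h₂ * g ∈ P) (hd : ∀ g, g ∉ P → h₂⁻¹ * h₁ * g ∈ P) :
    3 ≤ Fintype.card α ∧ ∃ z : ℝ, 0 < z ∧ z < (Fintype.card α : ℝ) - 1 ∧
      ∀ p : G ⧸ B, ∃ C : ℝ, 0 < C ∧
      ∀ (n : ℕ) (a : α), (((redW inv n a).filter fun w => (evalWord η w)⁻¹ • p = p).card : ℝ) ≤
        C * z ^ n := by
  obtain ⟨hinv, hne, hη, hgen⟩ := hsym
  obtain ⟨Y, hY⟩ : ∃ Y : Set (G ⧸ B), Y = {x | ∃ g ∈ P, (g : G ⧸ B) = x} := ⟨_, rfl⟩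
  have memY : ∀ g : G, (g : G ⧸ B) ∈ Y ↔ g ∈ P := by
    intro g
    rw [hY]
    constructor
    · rintro ⟨g', hg', e⟩
      have hx := QuotientGroup.eq.1 e
      have : g = g' * (g'⁻¹ * g) := by group
      rw [this, hP _ hx]
      exact hg'
    · exact fun h => ⟨g, h, rfl⟩
  have hsm : ∀ g g' : G, g • (g' : G ⧸ B) = ((g * g' : G) : G ⧸ B) :=
    fun _ _ => rfl
  have a1 : ∀ x ∈ Y, k • x ∉ Y := by
    intro x
    induction x using QuotientGroup.induction_on with | _ g =>
    rw [hsm, memY, memY]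
    exact hk g
  have a2 : ∀ x, x ∉ Y → h₁ • x ∈ Y := by
    intro x
    induction x using QuotientGroup.induction_on with | _ g =>
    rw [hsm, memY, memY]
    exact hh₁ g
  have a3 : ∀ x, x ∉ Y → h₂ • x ∈ Y := by
    intro x
    induction x using QuotientGroup.induction_on with | _ g =>
    rw [hsm, memY, memY]
    exact hh₂ g
  have a4 : ∀ x y, x ∉ Y → y ∉ Y → h₁ • x ≠ h₂ • y := by
    intro x y
    induction x using QuotientGroup.induction_on with | _ g =>
    induction y using QuotientGroup.induction_on with | _ g' =>
    intro hx hy e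
    rw [memY] at hx
    have h3 := hd g hx
    rw [← memY, mul_assoc, ← hsm, ← hsm, e, inv_smul_smul] at h3
    exact hy h3
  obtain ⟨f, T, hT, hTf, hf⟩ := exists_superharmonic η inv hη hgen Y k h₁ h₂ a1 a2 a3 a4
  obtain ⟨c3, z, z0, z1, z2⟩ := cogrowth η inv hinv hne hη f T hT hTf hf
  refine ⟨c3, z, z0, z1, fun p => ?_⟩
  obtain ⟨C, C0, hC⟩ := z2 p
  refine ⟨C, C0, fun n a => le_trans (le_of_eq ?_) (hC n a)⟩
  congr!

end Quot

section Assembly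

open Monoid Monoid.PushoutI Monoid.PushoutI.NormalWord

variable {A : Type*} [Group A] {Gf : Bool → Type*} [∀ i, Group (Gf i)] {φ : ∀ i, A →* Gf i}
  [∀ i, DecidableEq (Gf i)]

/-- The subset of the group used for the ping-pong on the vertices of type `b`. -/
def pingSet (d : Transversal φ) : Bool → Set (PushoutI φ)
  | true => {g | tau d g ≠ some false}
  | false => {g | tau d g = some true}

theorem pingSet_mul_of (d : Transversal φ) (b : Bool) (x : Gf b) (g : PushoutI φ) :
    g * of b x ∈ pingSet d b ↔ g ∈ pingSet d b := by
  cases b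
  · exact tau_mul_of d (by simp) x g
  · exact not_congr (tau_mul_of d (by simp) x g)

theorem pingSet_k (d : Transversal φ) (b : Bool) (k : Gf false) (hk : k ∉ (φ false).range)
    (g : PushoutI φ) (hg : g ∈ pingSet d b) : of false k * g ∉ pingSet d b := by
  cases b
  · have hg' : tau d g = some true := hg
    have := tau_cons d k g hk (by rw [hg']; simp)
    intro h
    have h' : tau d (of false k * g) = some true := h
    rw [this] at h'
    simp at h'
  · have hg' : tau d g ≠ some false := hg
    have := tau_cons d k g hk hg'
    exact fun h => h this

theorem pingSet_h (d : Transversal φ) (b : Bool) (k : Gf true) (hk : k ∉ (φ true).range)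
    (g : PushoutI φ) (hg : g ∉ pingSet d b) : of true k * g ∈ pingSet d b := by
  cases b
  · exact tau_cons d k g hk hg
  · have hg' : tau d g = some false := by
      by_contra h
      exact hg h
    have := tau_cons d k g hk (by rw [hg']; simp)
    change tau d _ ≠ _
    rw [this]
    simp

open Classical in
theorem tree_cogrowth (d : Transversal φ) {α : Type*} [Fintype α] [Nonempty α]
    (η : α → PushoutI φ) (inv : α → α)
    (hsym : IsSymmetricGen η inv) (k : Gf false) (hk : k ∉ (φ false).range)
    (h₁ h₂ : Gf true) (hh₁ : h₁ ∉ (φ true).range) (hh₂ : h₂ ∉ (φ true).range)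
    (hd : h₂⁻¹ * h₁ ∉ (φ true).range) (b : Bool) :
    3 ≤ Fintype.card α ∧ ∃ z : ℝ, 0 < z ∧ z < (Fintype.card α : ℝ) - 1 ∧
      ∀ p : PushoutI φ ⧸ (of (φ := φ) b).range, ∃ C : ℝ, 0 < C ∧
      ∀ (n : ℕ) (a : α), (((redW inv n a).filter fun w => (evalWord η w)⁻¹ • p = p).card : ℝ) ≤
        C * z ^ n := by
  refine quot_cogrowth (of (φ := φ) b).range η inv hsym (pingSet d b) ?_ (of false k) (of true h₁)
    (of true h₂) (pingSet_k d b k hk) (pingSet_h d b h₁ hh₁) (pingSet_h d b h₂ hh₂) ?_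
  · rintro _ ⟨x, rfl⟩ g
    exact pingSet_mul_of d b x g
  · intro g hg
    have := pingSet_h d b _ hd g hg
    rwa [map_mul, map_inv] at this

theorem generic_main (d : Transversal φ) {α : Type*} [Fintype α] [Nonempty α]
    (η : α → PushoutI φ) (inv : α → α)
    (hsym : IsSymmetricGen η inv) (k : Gf false) (hk : k ∉ (φ false).range)
    (h₁ h₂ : Gf true) (hh₁ : h₁ ∉ (φ true).range) (hh₂ : h₂ ∉ (φ true).range)
    (hd : h₂⁻¹ * h₁ ∉ (φ true).range) (E : List α → Prop)
    (hE : ∀ w, E w → ∃ (g : PushoutI φ) (i : Bool) (x : Gf i), evalWord η w = g * of i x * g⁻¹) :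
    ∃ C ρ : ℝ, 0 < C ∧ 0 < ρ ∧ ρ < 1 ∧ ∀ n : ℕ,
      (wordCount {w : List α | CyclicallyReduced inv w ∧ E w} n : ℝ) ≤
        C * ρ ^ n * (wordCount {w : List α | CyclicallyReduced inv w} n : ℝ) := by
  classical
  have hco := tree_cogrowth d η inv hsym k hk h₁ h₂ hh₁ hh₂ hd
  choose h3 z hz0 hzq hz using hco
  choose syl hsyl using fun a => exists_sval (φ := φ) (η a)
  have : ∀ a, Finite {p // p ∈ (syl a).inits} := fun a => (List.finite_toSet (syl a).inits).to_subtype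
  have : Fintype (Bool × Σ a, {p // p ∈ (syl a).inits}) := Fintype.ofFinite _
  refine count_final (ι := Bool × Σ a, {p // p ∈ (syl a).inits}) inv hsym.1 hsym.2.1 (h3 true) E
    (fun i w => (evalWord η w)⁻¹ • ((sval φ i.2.2.1 : PushoutI φ) : PushoutI φ ⧸ (of (φ := φ) i.1).range) =
      ((sval φ i.2.2.1 : PushoutI φ) : PushoutI φ ⧸ (of (φ := φ) i.1).range))
    (max (z true) (z false)) (lt_max_of_lt_left (hz0 true)) (max_lt (hzq true) (hzq false)) ?_ ?_
  · intro i
    obtain ⟨C, hC, h⟩ := hz i.1 ((sval φ i.2.2.1 : PushoutI φ) : PushoutI φ ⧸ (of (φ := φ) i.1).range)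
    refine ⟨C, hC, fun n a => ?_⟩
    have h4 : z i.1 ≤ max (z true) (z false) := by
      cases i.1
      · exact le_max_right _ _
      · exact le_max_left _ _
    refine le_trans (le_trans (le_of_eq ?_) (h n a)) ?_
    · congr!
    · have := pow_le_pow_left₀ (hz0 i.1).le h4 n
      gcongr
  · intro w hw hEw
    obtain ⟨w₁, a, w₂, p, e, hp, i, x, hx⟩ := elliptic_word d η syl hsyl w hw (hE w hEw)
    refine ⟨w₁, a, w₂, ⟨i, a, p, hp⟩, e, ?_⟩
    rw [hx]
    have hsm : ∀ g g' : PushoutI φ, g • (g' : PushoutI φ ⧸ (of (φ := φ) i).range) = ((g * g' : PushoutI φ) : PushoutI φ ⧸ (of (φ := φ) i).range) :=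
      fun _ _ => rfl
    dsimp only
    rw [hsm, QuotientGroup.eq]
    exact ⟨x, by group⟩

end Assembly
/-- For `G = H ∗_A K` with `[H:A] ≥ 3` and `[K:A] ≥ 2` and a finite
symmetric generating set `η : Σ → G`, there are constants `C > 0` and `0 < ρ < 1` such
that for every `n` the number of cyclically reduced words of length `n` representing
elliptic elements is at most `C·ρⁿ` times the number of all cyclically reduced words of
length `n`. -/
theorem stmt_4 {A : Type*} {H K : Type u} [Group A] [Group H] [Group K]
    (φ : A →* H) (ψ : A →* K) (hφ : Function.Injective φ) (hψ : Function.Injective ψ)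
    (hH3 : 3 ≤ Cardinal.mk (H ⧸ φ.range))
    (hK2 : 2 ≤ Cardinal.mk (K ⧸ ψ.range))
    {α : Type*} [Fintype α] (η : α → AmalgProd φ ψ) (inv : α → α)
    (hsym : IsSymmetricGen η inv) :
    ∃ C ρ : ℝ, 0 < C ∧ 0 < ρ ∧ ρ < 1 ∧ ∀ n : ℕ,
      (wordCount {w : List α | CyclicallyReduced inv w ∧
          IsElliptic (((amalgH φ ψ).range : Set (AmalgProd φ ψ)) ∪ (amalgK φ ψ).range)
            (evalWord η w)} n : ℝ) ≤
        C * ρ ^ n * (wordCount {w : List α | CyclicallyReduced inv w} n : ℝ) := by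
  classical
  have hinj : ∀ i, Function.Injective (amalgMaps φ ψ i) := by
    intro i
    cases i
    · exact hψ
    · exact hφ
  obtain ⟨d⟩ := Monoid.PushoutI.NormalWord.transversal_nonempty (amalgMaps φ ψ) hinj
  obtain ⟨k, hk⟩ : ∃ k : K, k ∉ ψ.range := by
    obtain ⟨x, y, hxy⟩ := Cardinal.two_le_iff.1 hK2
    induction x using QuotientGroup.induction_on with | _ x =>
    induction y using QuotientGroup.induction_on with | _ y =>
    exact ⟨x⁻¹ * y, fun h => hxy (QuotientGroup.eq.2 h)⟩
  obtain ⟨h₁, hh₁⟩ : ∃ h : H, h ∉ φ.range := by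
    obtain ⟨x, hx, _⟩ := Cardinal.exists_ne_ne_of_three_le hH3 ((1 : H) : H ⧸ φ.range) ((1 : H) : H ⧸ φ.range)
    induction x using QuotientGroup.induction_on with | _ x =>
    exact ⟨x, fun h => hx (QuotientGroup.eq.2 (by simpa using h))⟩
  obtain ⟨h₂, hh₂, hd⟩ : ∃ h : H, h ∉ φ.range ∧ h⁻¹ * h₁ ∉ φ.range := by
    obtain ⟨x, hx, hx'⟩ := Cardinal.exists_ne_ne_of_three_le hH3 ((1 : H) : H ⧸ φ.range) (h₁ : H ⧸ φ.range)
    induction x using QuotientGroup.induction_on with | _ x =>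
    exact ⟨x, fun h => hx (QuotientGroup.eq.2 (by simpa using h)),
      fun h => hx' (QuotientGroup.eq.2 h)⟩
  have hα : Nonempty α := by
    by_contra hcon
    rw [not_nonempty_iff] at hcon
    have hgen := hsym.2.2.2
    rw [Set.range_eq_empty, Subgroup.closure_empty] at hgen
    have h1 : (Monoid.PushoutI.of (φ := amalgMaps φ ψ) false k) ∈
        (⊤ : Subgroup (AmalgProd φ ψ)) := Subgroup.mem_top _
    rw [← hgen, Subgroup.mem_bot] at h1
    have h2 := tau_cons d (i := false) k 1 hk (by rw [tau_one]; simp)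
    rw [h1, mul_one, tau_one] at h2
    cases h2
  refine generic_main d η inv hsym k hk h₁ h₂ hh₁ hh₂ hd _ ?_
  rintro w ⟨h, hS, hconj⟩
  obtain ⟨g, hg⟩ := isConj_iff.1 hconj
  rcases hS with ⟨x, rfl⟩ | ⟨x, rfl⟩
  · exact ⟨g, true, x, hg.symm⟩
  · exact ⟨g, false, x, hg.symm⟩
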